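/- Let P be an orthogonal projection on ℂ^E, L Hermitian with P^⊥ L P^⊥ = L, and k ∈ ℝ, k ≠ 0. Then the matrix S(k) = -(P + L + ik P^⊥)^{-1}(P + L - ik P^⊥) is unitary. -/

import Mathlib

open Matrix Complex

/-- The vertex scattering matrix
`S(k) = -(P + L + ik P^⊥)⁻¹ (P + L - ik P^⊥)` of the Laplacian with boundary
conditions `(P, L)` is unitary for real `k ≠ 0`. -/
theorem scattering_matrix_unitary
    (E : ℕ) (P L : Matrix (Fin E) (Fin E) ℂ)
    (hP : P.IsHermitian) (hP2 : P * P = P)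
    (hL : L.IsHermitian) (hLP : (1 - P) * L * (1 - P) = L)
    (k : ℝ) (hk : k ≠ 0) :
    -((P + L + (Complex.I * (k : ℂ)) • (1 - P))⁻¹
        * (P + L - (Complex.I * (k : ℂ)) • (1 - P)))
      ∈ Matrix.unitaryGroup (Fin E) ℂ := by
  have hkc : (k : ℂ) ≠ 0 := by exact_mod_cast hk
  have hQh : (1 - P)ᴴ = 1 - P := by rw [conjTranspose_sub, conjTranspose_one, hP.eq]
  have hPQ : P * (1 - P) = 0 := by rw [mul_sub, hP2, mul_one, sub_self]
  have hQP : (1 - P) * P = 0 := by rw [sub_mul, hP2, one_mul, sub_self]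
  have hQQ : (1 - P) * (1 - P) = 1 - P := by rw [sub_mul, hPQ, one_mul, sub_zero]
  have hPQ1 : P + (1 - P) = 1 := by abel
  generalize hQ : 1 - P = Q at *
  have hPL : P * L = 0 := by
    rw [← hLP, ← mul_assoc, ← mul_assoc, hPQ, zero_mul, zero_mul]
  have hLP0 : L * P = 0 := by rw [← hLP, mul_assoc, hQP, mul_zero]
  have hQL : Q * L = L := by rw [← hQ, sub_mul, hPL, one_mul, sub_zero]
  have hLQ : L * Q = L := by rw [← hQ, mul_sub, hLP0, mul_one, sub_zero]
  set A := P + L + (Complex.I * (k : ℂ)) • Q with hA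
  set B := P + L - (Complex.I * (k : ℂ)) • Q with hB
  have hAB' : A * B = (P + (k : ℂ) • Q) * (P + (k : ℂ) • Q) + L * L := by
    simp only [hA, hB, mul_add, add_mul, mul_sub, smul_mul_assoc, mul_smul_comm, hP2, hPQ,
      hQP, hQQ, hPL, hLP0, hQL, hLQ, smul_add, smul_sub, smul_smul, smul_zero, zero_add, add_zero]
    have : Complex.I * (k : ℂ) * (Complex.I * k) = -(k * k) := by
      linear_combination (k * k : ℂ) * Complex.I_mul_I
    rw [this, neg_smul]
    abel
  have hBA : B * A = A * B := by
    simp only [hA, hB, mul_add, add_mul, mul_sub, sub_mul, smul_mul_assoc, mul_smul_comm, hP2,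
      hPQ, hQP, hQQ, hPL, hLP0, hQL, hLQ, smul_add, smul_sub, smul_smul, smul_zero, zero_add, add_zero]
    abel
  have hAh : Aᴴ = B := by
    simp [hA, hB, conjTranspose_add, conjTranspose_smul, hP.eq, hL.eq, hQh, sub_eq_add_neg]
  have hBh : Bᴴ = A := by rw [← hAh, conjTranspose_conjTranspose]
  have hM : IsUnit (P + (k : ℂ) • Q) := by
    refine IsUnit.of_mul_eq_one (P + (k : ℂ)⁻¹ • Q) ?_
    simp only [mul_add, add_mul, smul_mul_assoc, mul_smul_comm, hP2, hPQ,
      hQP, hQQ, smul_add, smul_sub, smul_smul, smul_zero, zero_add, add_zero]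
    rw [inv_mul_cancel₀ hkc, one_smul, hPQ1]
  have hMh : (P + (k : ℂ) • Q)ᴴ = P + (k : ℂ) • Q := by
    simp [conjTranspose_add, conjTranspose_smul, hP.eq, hQh]
  have hdet : IsUnit (A * B).det := by
    open scoped ComplexOrder in
    have hpd : (A * B).PosDef := by
      rw [hAB']
      refine PosDef.add_posSemidef ?_ ?_
      · have := PosDef.conjTranspose_mul_self (P + (k : ℂ) • Q)
          (Matrix.mulVec_injective_of_isUnit hM)
        rwa [hMh] at this
      · have := posSemidef_conjTranspose_mul_self L
        rwa [hL.eq] at this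
    open scoped ComplexOrder in
    exact (isUnit_iff_isUnit_det _).1 hpd.isUnit
  rw [det_mul, IsUnit.mul_iff] at hdet
  rw [mem_unitaryGroup_iff, star_eq_conjTranspose, conjTranspose_neg, neg_mul_neg,
    conjTranspose_mul, conjTranspose_nonsing_inv, hAh, hBh]
  calc A⁻¹ * B * (A * B⁻¹) = A⁻¹ * (B * A) * B⁻¹ := by simp only [mul_assoc]
    _ = (A⁻¹ * A) * (B * B⁻¹) := by rw [hBA]; simp only [mul_assoc]
    _ = 1 := by rw [nonsing_inv_mul _ hdet.1, mul_nonsing_inv _ hdet.2, mul_one]
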